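/- arXiv:1104.2371 — 2 statements merged into one kernel-verified Lean document; each statement's English description precedes it below -/
import Mathlib

section
/- Let V̄ = F^{ab} with the image of a word u denoted ū, and let V̄_Y ≤ V̄ be the subgroup generated by ȳ_1,…,ȳ_k. Fix c = y_i ∈ Y. Then: (i) for every f ∈ K_{n,k,l} there exists w ∈ F with f(c) = w c w^{-1}; (ii) the class of w̄ in the quotient V̄/⟨V̄_Y, c̄⟩ = V̄/V̄_Y is independent of the choice of w; and (iii) the resulting map J'_c : K_{n,k,l} → V̄/V̄_Y, sending f to this class, is a group homomorphism. -/
namespace Birman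

/-- The generating set of the free group `F_{n,k,l}`: `X ∪ Y ∪ Z`. -/
abbrev Gen (n k l : ℕ) := Fin n ⊕ (Fin k ⊕ Fin l)

/-- The free group `F_{n,k,l}` on `X ∪ Y ∪ Z`. -/
abbrev FG (n k l : ℕ) := FreeGroup (Gen n k l)

variable {n k l : ℕ}

/-- The generator `x_i`. -/
def xg (n k l : ℕ) (i : Fin n) : Gen n k l := Sum.inl i
/-- The generator `y_j`. -/
def yg (n k l : ℕ) (j : Fin k) : Gen n k l := Sum.inr (Sum.inl j)
/-- The generator `z_m`. -/
def zg (n k l : ℕ) (m : Fin l) : Gen n k l := Sum.inr (Sum.inr m)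

/-- `A_{n,k,l}`: automorphisms sending each generator in `Y ∪ Z` to a conjugate of itself. -/
def A (n k l : ℕ) : Subgroup (MulAut (FG n k l)) where
  carrier := {f | ∀ s : Fin k ⊕ Fin l,
    IsConj (FreeGroup.of (Sum.inr s : Gen n k l)) (f (FreeGroup.of (Sum.inr s)))}
  one_mem' := by
    intro s
    rw [MulAut.one_apply]
  mul_mem' := by
    intro f g hf hg s
    rw [MulAut.mul_apply]
    exact (hf s).trans (f.toMonoidHom.map_isConj (hg s))
  inv_mem' := by
    intro f hf s
    have h := (f⁻¹ : MulAut (FG n k l)).toMonoidHom.map_isConj (hf s)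
    simp only [MulEquiv.toMonoidHom_eq_coe, MonoidHom.coe_coe] at h
    have h2 : (f⁻¹ : MulAut (FG n k l)) (f (FreeGroup.of (Sum.inr s))) = FreeGroup.of (Sum.inr s) :=
      MulAut.inv_apply_self _ f _
    rw [h2] at h
    exact h.symm

/-- The projection `F_{n,k,l} → F_{n,0,l}` killing the generators in `Y`. -/
def proj (n k l : ℕ) : FG n k l →* FG n 0 l :=
  FreeGroup.lift fun g => match g with
    | Sum.inl i => FreeGroup.of (Sum.inl i)
    | Sum.inr (Sum.inl _) => 1
    | Sum.inr (Sum.inr m) => FreeGroup.of (Sum.inr (Sum.inr m))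

/-- Automorphisms commuting with the projection to `F_{n,0,l}`, i.e. inducing the identity
on `F_{n,k,l}/N ≅ F_{n,0,l}`. -/
def fixProj (n k l : ℕ) : Subgroup (MulAut (FG n k l)) where
  carrier := {f | ∀ w : FG n k l, proj n k l (f w) = proj n k l w}
  one_mem' := by intro w; simp
  mul_mem' := by
    intro f g hf hg w
    rw [MulAut.mul_apply]
    exact (hf (g w)).trans (hg w)
  inv_mem' := by
    intro f hf w
    have h := hf ((f⁻¹ : MulAut (FG n k l)) w)
    rw [MulAut.apply_inv_self] at h
    exact h.symm

/-- `K_{n,k,l}`, the kernel of `ρ : A_{n,k,l} → A_{n,0,l}`: those elements of `A_{n,k,l}`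
that induce the identity automorphism of `F_{n,k,l}/N ≅ F_{n,0,l}`. -/
def K (n k l : ℕ) : Subgroup (MulAut (FG n k l)) := A n k l ⊓ fixProj n k l

/-- `f` is the automorphism `M_{v,w}` : `v ↦ w v`, fixing all other generators. -/
def IsMul (f : MulAut (FG n k l)) (v w : Gen n k l) : Prop :=
  f (FreeGroup.of v) = FreeGroup.of w * FreeGroup.of v ∧
    ∀ u : Gen n k l, u ≠ v → f (FreeGroup.of u) = FreeGroup.of u

/-- `f` is the automorphism `M_{v⁻¹,w}` : `v ↦ v w⁻¹`, fixing all other generators. -/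
def IsMulInv (f : MulAut (FG n k l)) (v w : Gen n k l) : Prop :=
  f (FreeGroup.of v) = FreeGroup.of v * (FreeGroup.of w)⁻¹ ∧
    ∀ u : Gen n k l, u ≠ v → f (FreeGroup.of u) = FreeGroup.of u

/-- `f` is the automorphism `C_{v,w}` : `v ↦ w v w⁻¹`, fixing all other generators. -/
def IsConjGen (f : MulAut (FG n k l)) (v w : Gen n k l) : Prop :=
  f (FreeGroup.of v) = FreeGroup.of w * FreeGroup.of v * (FreeGroup.of w)⁻¹ ∧
    ∀ u : Gen n k l, u ≠ v → f (FreeGroup.of u) = FreeGroup.of u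

end Birman

namespace Birman

/-- `V̄_Y ≤ V̄ = F^{ab}`: the subgroup generated by the images of `y_1, …, y_k`. -/
def VY (n k l : ℕ) : Subgroup (Abelianization (FG n k l)) :=
  Subgroup.closure (Set.range fun j : Fin k => Abelianization.of (FreeGroup.of (yg n k l j)))

variable {n k l : ℕ}

/-- The exponent sum of the generator `b`. -/
def expo (b : Gen n k l) : FG n k l →* Multiplicative ℤ :=
  FreeGroup.lift fun g => if g = b then Multiplicative.ofAdd 1 else 1

/-- The shear `(x, y) ↦ (x, y + x)`. -/
def shear : Equiv.Perm (ℤ × ℤ) where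
  toFun p := (p.1, p.2 + p.1)
  invFun p := (p.1, p.2 - p.1)
  left_inv p := by simp
  right_inv p := by simp

/-- The translation `(x, y) ↦ (x + 1, y)`. -/
def shift : Equiv.Perm (ℤ × ℤ) where
  toFun p := (p.1 + 1, p.2)
  invFun p := (p.1 - 1, p.2)
  left_inv p := by simp
  right_inv p := by simp

/-- A Heisenberg-type action of the free group on `ℤ × ℤ`. -/
def heis (a b : Gen n k l) : FG n k l →* Equiv.Perm (ℤ × ℤ) :=
  FreeGroup.lift fun g => if g = b then shift else if g = a then shear else 1

theorem heis_fst (a b : Gen n k l) (u : FG n k l) :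
    ∀ p : ℤ × ℤ, (heis a b u p).1 = p.1 + (expo b u).toAdd := by
  have gen : ∀ (g : Gen n k l) (p : ℤ × ℤ), (heis a b (FreeGroup.of g) p).1
      = p.1 + (expo b (FreeGroup.of g)).toAdd := by
    intro g p
    simp only [heis, expo, FreeGroup.lift_apply_of]
    split_ifs <;> simp [shift, shear]
  induction u using FreeGroup.induction_on with
  | C1 => intro p; simp
  | of g => exact gen g
  | inv_of g ih =>
    intro p
    have := gen g ((heis a b (FreeGroup.of g))⁻¹ p)
    rw [← Equiv.Perm.mul_apply, mul_inv_cancel, Equiv.Perm.one_apply] at this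
    rw [map_inv, map_inv, toAdd_inv, this]
    ring
  | mul x y hx hy =>
    intro p
    rw [map_mul, map_mul, Equiv.Perm.mul_apply, hx, hy, toAdd_mul]
    ring

theorem expo_eq_one (a b : Gen n k l) (hab : a ≠ b) (u : FG n k l)
    (h : u * FreeGroup.of a = FreeGroup.of a * u) : expo b u = 1 := by
  have ha : heis a b (FreeGroup.of a) = shear := by simp [heis, hab]
  have h1 := congrArg (fun w => (heis a b w (0, 0)).2) h
  simp only [map_mul, Equiv.Perm.mul_apply, ha] at h1
  have h2 := heis_fst a b u (0, 0)
  have h3 : shear (0, 0) = (0, 0) := by simp [shear]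
  rw [h3] at h1
  have h4 : (shear (heis a b u (0, 0))).2 = (heis a b u (0, 0)).2 + (heis a b u (0, 0)).1 := rfl
  rw [h4, h2] at h1
  have : (expo b u).toAdd = 0 := by simpa using h1
  exact this

/-- The map `F → V̄ / V̄_Y`. -/
def qmap (n k l : ℕ) : FG n k l →* Abelianization (FG n k l) ⧸ VY n k l :=
  (QuotientGroup.mk' (VY n k l)).comp Abelianization.of

theorem qmap_eq_one_iff (u : FG n k l) : qmap n k l u = 1 ↔ Abelianization.of u ∈ VY n k l := by
  simp [qmap]

theorem qmap_y (j : Fin k) : qmap n k l (FreeGroup.of (Sum.inr (Sum.inl j))) = 1 := by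
  rw [qmap_eq_one_iff]
  exact Subgroup.subset_closure ⟨j, rfl⟩

theorem qmap_prod (u : FG n k l) :
    qmap n k l u = ∏ b : Gen n k l, qmap n k l (FreeGroup.of b) ^ (expo b u).toAdd := by
  induction u using FreeGroup.induction_on with
  | C1 => simp
  | of g =>
    rw [Finset.prod_eq_single g]
    · simp [expo]
    · intro b _ hb
      simp [expo, hb.symm]
    · simp
  | inv_of g ih => simp only [map_inv, toAdd_inv, zpow_neg, Finset.prod_inv_distrib, ← ih]
  | mul x y hx hy => simp only [map_mul, toAdd_mul, zpow_add, Finset.prod_mul_distrib, ← hx, ← hy]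

theorem qmap_commute (i : Fin k) (u : FG n k l)
    (h : u * FreeGroup.of (yg n k l i) = FreeGroup.of (yg n k l i) * u) : qmap n k l u = 1 := by
  rw [qmap_prod]
  apply Finset.prod_eq_one
  intro b _
  by_cases hb : yg n k l i = b
  · subst hb
    rw [yg, qmap_y, one_zpow]
  · rw [expo_eq_one _ b hb u h]
    simp

/-- The obvious section of `proj`. -/
def sect (n k l : ℕ) : FG n 0 l →* FG n k l :=
  FreeGroup.lift fun g => match g with
    | Sum.inl i => FreeGroup.of (Sum.inl i)
    | Sum.inr (Sum.inl _) => 1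
    | Sum.inr (Sum.inr m) => FreeGroup.of (Sum.inr (Sum.inr m))

theorem qmap_sect (u : FG n k l) : qmap n k l (sect n k l (proj n k l u)) = qmap n k l u := by
  have : ((qmap n k l).comp (sect n k l)).comp (proj n k l) = qmap n k l := by
    ext g
    rcases g with i | j | m
    · simp [sect, proj]
    · simp [proj, qmap_y]
    · simp [sect, proj]
  exact DFunLike.congr_fun this u

theorem qmap_unique (i : Fin k) (w w' : FG n k l)
    (h : w * FreeGroup.of (yg n k l i) * w⁻¹ = w' * FreeGroup.of (yg n k l i) * w'⁻¹) :
    qmap n k l w = qmap n k l w' := by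
  have := qmap_commute i (w'⁻¹ * w) (by
    have h2 := congrArg (fun t => w'⁻¹ * t * w) h
    simpa [mul_assoc] using h2)
  rw [map_mul, map_inv, inv_mul_eq_one] at this
  exact this.symm

/-- **The Johnson homomorphism `J'_c` for `c = y_i ∈ Y`.**  (i) every `f ∈ K_{n,k,l}` sends `c`
to `w c w⁻¹` for some `w ∈ F`; (ii) the class of `w̄` in `V̄/⟨V̄_Y, c̄⟩ = V̄/V̄_Y` does not
depend on the choice of `w`; (iii) `f ↦ [w̄] ∈ V̄/V̄_Y` is a group homomorphism on
`K_{n,k,l}`. -/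
theorem Jy_well_defined_homomorphism (n k l : ℕ) (i0 : Fin k) :
    (∀ f ∈ K n k l, ∃ w : FG n k l,
        f (FreeGroup.of (yg n k l i0)) = w * FreeGroup.of (yg n k l i0) * w⁻¹) ∧
    (∀ f ∈ K n k l, ∀ w w' : FG n k l,
        f (FreeGroup.of (yg n k l i0)) = w * FreeGroup.of (yg n k l i0) * w⁻¹ →
        f (FreeGroup.of (yg n k l i0)) = w' * FreeGroup.of (yg n k l i0) * w'⁻¹ →
        Abelianization.of w * (Abelianization.of w')⁻¹ ∈ VY n k l) ∧
    (∀ f ∈ K n k l, ∀ g ∈ K n k l, ∀ wf wg wfg : FG n k l,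
        f (FreeGroup.of (yg n k l i0)) = wf * FreeGroup.of (yg n k l i0) * wf⁻¹ →
        g (FreeGroup.of (yg n k l i0)) = wg * FreeGroup.of (yg n k l i0) * wg⁻¹ →
        (f * g) (FreeGroup.of (yg n k l i0)) = wfg * FreeGroup.of (yg n k l i0) * wfg⁻¹ →
        Abelianization.of wfg * (Abelianization.of wf * Abelianization.of wg)⁻¹ ∈ VY n k l) := by
  refine ⟨?_, ?_, ?_⟩
  · intro f hf
    obtain ⟨w, hw⟩ := isConj_iff.1 (hf.1 (Sum.inl i0))
    exact ⟨w, hw.symm⟩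
  · intro f _ w w' h h'
    have := qmap_unique i0 w w' (h.symm.trans h')
    rw [← map_inv, ← map_mul, ← qmap_eq_one_iff, map_mul, map_inv, this, mul_inv_cancel]
  · intro f hf g _ wf wg wfg h1 h2 h3
    have h4 := qmap_unique i0 wfg (f wg * wf) (by
      rw [← h3, MulAut.mul_apply, h2, map_mul, map_mul, h1, map_inv]
      group)
    have h5 : qmap n k l (f wg) = qmap n k l wg := by
      rw [← qmap_sect, hf.2 wg, qmap_sect]
    rw [← map_mul, ← map_inv, ← map_mul, ← qmap_eq_one_iff, map_mul, map_inv, h4, map_mul,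
      map_mul, h5, mul_comm, mul_comm (qmap n k l wf), inv_mul_cancel]

end Birman
end

section
/- The quotient N_Y/M is an abelian group, and it is a free ℤ-module with basis {y^v : v ∈ V̄/V̄_Y}, where for v ∈ V̄/V̄_Y the element y^v ∈ N_Y/M is the (well-defined) image of ṽ y ṽ^{-1} for any ṽ ∈ F projecting to v; in particular the map v ↦ y^v is injective and its image is a ℤ-basis of N_Y/M. -/
namespace Birman

/-- The distinguished element `y = y_1` of `Y` (for `k ≥ 1`). -/
def y0 (n k l : ℕ) [hk : Fact (0 < k)] : FG n k l :=
  FreeGroup.of (yg n k l ⟨0, hk.out⟩)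

/-- `N_Y`: the normal closure of `Y` in `F_{n,k,l}`. -/
def NY (n k l : ℕ) : Subgroup (FG n k l) :=
  Subgroup.normalClosure (Set.range fun j : Fin k => FreeGroup.of (yg n k l j))

/-- `N_{Y'}`: the normal closure of `Y' = Y \ {y}` in `F_{n,k,l}`. -/
def NY' (n k l : ℕ) [hk : Fact (0 < k)] : Subgroup (FG n k l) :=
  Subgroup.normalClosure
    {w | ∃ j : Fin k, j ≠ ⟨0, hk.out⟩ ∧ w = FreeGroup.of (yg n k l j)}

/-- The subgroup `M ≤ F` generated by `N_{Y'}`, `[N_Y, N_Y]` and `[N_Y, [F,F]]`. -/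
def Msub (n k l : ℕ) [Fact (0 < k)] : Subgroup (FG n k l) :=
  NY' n k l ⊔ ⁅NY n k l, NY n k l⁆ ⊔ ⁅NY n k l, ⁅(⊤ : Subgroup (FG n k l)), ⊤⁆⁆

instance NY_normal (n k l : ℕ) : (NY n k l).Normal :=
  Subgroup.normalClosure_normal

instance NY'_normal (n k l : ℕ) [Fact (0 < k)] : (NY' n k l).Normal :=
  Subgroup.normalClosure_normal

instance Msub_normal (n k l : ℕ) [Fact (0 < k)] : (Msub n k l).Normal := by
  unfold Msub
  infer_instance

theorem y0_mem_NY (n k l : ℕ) [hk : Fact (0 < k)] : y0 n k l ∈ NY n k l :=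
  Subgroup.subset_normalClosure ⟨⟨0, hk.out⟩, rfl⟩

theorem conj_y0_mem_NY (n k l : ℕ) [Fact (0 < k)] (v : FG n k l) :
    v * y0 n k l * v⁻¹ ∈ NY n k l :=
  (NY_normal n k l).conj_mem _ (y0_mem_NY n k l) v

end Birman

namespace Birman

instance MsubOf_normal (n k l : ℕ) [Fact (0 < k)] :
    ((Msub n k l).subgroupOf (NY n k l)).Normal :=
  (Msub_normal n k l).subgroupOf _

/-- The quotient group `N_Y/M`. -/
def QNY (n k l : ℕ) [Fact (0 < k)] :=
  ↥(NY n k l) ⧸ (Msub n k l).subgroupOf (NY n k l)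

instance (n k l : ℕ) [Fact (0 < k)] : Group (QNY n k l) :=
  QuotientGroup.Quotient.group _

section Helpers

open scoped commutatorElement

/-- `Q = V̄/V̄_Y`. -/
abbrev QQ (n k l : ℕ) := Abelianization (FG n k l) ⧸ VY n k l

/-- The projection `F → V̄/V̄_Y`. -/
def prQ (n k l : ℕ) : FG n k l →* QQ n k l :=
  (QuotientGroup.mk' (VY n k l)).comp Abelianization.of

/-- The translation action of `Q` on `ℤ[Q]`. -/
noncomputable def act (Q : Type) [Group Q] : Q →* MulAut (Multiplicative (Q →₀ ℤ)) where
  toFun q := AddEquiv.toMultiplicative (Finsupp.domCongr (Equiv.mulLeft q))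
  map_one' := by
    ext x
    change Finsupp.equivMapDomain (Equiv.mulLeft (1 : Q)) (Multiplicative.toAdd x) _ = _
    simp
    rfl
  map_mul' a b := by
    ext x c
    change Finsupp.equivMapDomain (Equiv.mulLeft (a * b)) (Multiplicative.toAdd x) _ =
      Finsupp.equivMapDomain (Equiv.mulLeft a)
        (Finsupp.equivMapDomain (Equiv.mulLeft b) (Multiplicative.toAdd x)) _
    simp only [Finsupp.equivMapDomain_apply, Equiv.mulLeft_symm_apply, mul_inv_rev, mul_assoc]

theorem act_single (Q : Type) [Group Q] (q : Q) :
    act Q q (Multiplicative.ofAdd (Finsupp.single 1 1)) =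
      Multiplicative.ofAdd (Finsupp.single q 1) := by
  change Multiplicative.ofAdd (Finsupp.equivMapDomain (Equiv.mulLeft q) (Finsupp.single 1 1)) = _
  simp

open Classical in
/-- The map from `F` to the wreath product. -/
noncomputable def phi (n k l : ℕ) [hk : Fact (0 < k)] :
    FG n k l →* (Multiplicative (QQ n k l →₀ ℤ)) ⋊[act (QQ n k l)] (QQ n k l) :=
  FreeGroup.lift fun g =>
    if g = yg n k l ⟨0, hk.out⟩ then ⟨Multiplicative.ofAdd (Finsupp.single 1 1), 1⟩
    else ⟨1, prQ n k l (FreeGroup.of g)⟩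

theorem prQ_y (n k l : ℕ) (j : Fin k) : prQ n k l (FreeGroup.of (yg n k l j)) = 1 := by
  change QuotientGroup.mk (Abelianization.of _) = (1 : QQ n k l)
  rw [QuotientGroup.eq_one_iff]
  exact Subgroup.subset_closure ⟨j, rfl⟩

theorem phi_y0 (n k l : ℕ) [hk : Fact (0 < k)] :
    phi n k l (y0 n k l) = ⟨Multiplicative.ofAdd (Finsupp.single 1 1), 1⟩ := by
  simp [phi, y0]

theorem phi_y (n k l : ℕ) [hk : Fact (0 < k)] (j : Fin k) (hj : j ≠ ⟨0, hk.out⟩) :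
    phi n k l (FreeGroup.of (yg n k l j)) = 1 := by
  have : yg n k l j ≠ yg n k l ⟨0, hk.out⟩ := by
    intro h
    exact hj (by simpa [yg] using h)
  simp only [phi, FreeGroup.lift_apply_of, if_neg this, prQ_y]
  rfl

theorem phi_right (n k l : ℕ) [hk : Fact (0 < k)] (w : FG n k l) :
    (phi n k l w).right = prQ n k l w := by
  have : (SemidirectProduct.rightHom).comp (phi n k l) = prQ n k l := by
    ext g
    simp only [phi, MonoidHom.comp_apply, FreeGroup.lift_apply_of]
    split_ifs with h
    · subst h
      rw [prQ_y]; rfl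
    · rfl
  exact DFunLike.congr_fun this w

theorem NY_le_ker (n k l : ℕ) : NY n k l ≤ (prQ n k l).ker := by
  refine Subgroup.normalClosure_le_normal ?_
  rintro _ ⟨j, rfl⟩
  exact prQ_y n k l j

theorem comm_le_ker (n k l : ℕ) :
    ⁅(⊤ : Subgroup (FG n k l)), ⊤⁆ ≤ (prQ n k l).ker := by
  rw [Subgroup.commutator_le]
  intro a _ b _
  rw [MonoidHom.mem_ker, map_commutatorElement, commutatorElement_eq_one_iff_mul_comm]
  exact mul_comm _ _

theorem phi_comm (n k l : ℕ) [hk : Fact (0 < k)] {a b : FG n k l}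
    (ha : a ∈ (prQ n k l).ker) (hb : b ∈ (prQ n k l).ker) :
    ⁅a, b⁆ ∈ (phi n k l).ker := by
  rw [MonoidHom.mem_ker, map_commutatorElement, commutatorElement_eq_one_iff_mul_comm]
  rw [MonoidHom.mem_ker, ← phi_right] at ha hb
  ext1
  · rw [SemidirectProduct.mul_left, SemidirectProduct.mul_left, ha, hb, map_one]
    exact mul_comm _ _
  · rw [SemidirectProduct.mul_right, SemidirectProduct.mul_right, ha, hb]

theorem Msub_le_ker (n k l : ℕ) [hk : Fact (0 < k)] : Msub n k l ≤ (phi n k l).ker := by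
  refine sup_le (sup_le ?_ ?_) ?_
  · refine Subgroup.normalClosure_le_normal ?_
    rintro _ ⟨j, hj, rfl⟩
    exact phi_y n k l j hj
  · rw [Subgroup.commutator_le]
    intro a ha b hb
    exact phi_comm n k l (NY_le_ker n k l ha) (NY_le_ker n k l hb)
  · rw [Subgroup.commutator_le]
    intro a ha b hb
    exact phi_comm n k l (NY_le_ker n k l ha) (comm_le_ker n k l hb)

/-- The map `N_Y → ℤ[Q]`. -/
noncomputable def leftHom (n k l : ℕ) [hk : Fact (0 < k)] :
    NY n k l →* Multiplicative (QQ n k l →₀ ℤ) where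
  toFun w := (phi n k l w).left
  map_one' := by simp
  map_mul' a b := by
    have ha := NY_le_ker n k l a.2
    rw [MonoidHom.mem_ker, ← phi_right] at ha
    simp [ha]

theorem leftHom_conj (n k l : ℕ) [hk : Fact (0 < k)] (v : FG n k l) :
    leftHom n k l ⟨v * y0 n k l * v⁻¹, conj_y0_mem_NY n k l v⟩ =
      Multiplicative.ofAdd (Finsupp.single (prQ n k l v) 1) := by
  change (phi n k l (v * y0 n k l * v⁻¹)).left = _
  rw [map_mul, map_mul, map_inv, phi_y0, ← phi_right]
  simp [-map_inv, ← MulAut.mul_apply, ← map_mul]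
  exact act_single _ _

/-- The induced map on `N_Y/M`. -/
noncomputable def eHom (n k l : ℕ) [hk : Fact (0 < k)] :
    QNY n k l →* Multiplicative (QQ n k l →₀ ℤ) :=
  QuotientGroup.lift _ (leftHom n k l) (by
    intro x hx
    have := Msub_le_ker n k l (Subgroup.mem_subgroupOf.1 hx)
    rw [MonoidHom.mem_ker] at this
    change (phi n k l x).left = 1
    rw [this]; rfl)

theorem QNY_comm (n k l : ℕ) [hk : Fact (0 < k)] (a b : QNY n k l) : a * b = b * a := by
  obtain ⟨a, rfl⟩ := QuotientGroup.mk_surjective a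
  obtain ⟨b, rfl⟩ := QuotientGroup.mk_surjective b
  refine (QuotientGroup.eq (s := (Msub n k l).subgroupOf (NY n k l))).2 ?_
  rw [Subgroup.mem_subgroupOf]
  have h : ⁅((b⁻¹ : NY n k l) : FG n k l), ((a⁻¹ : NY n k l) : FG n k l)⁆ ∈ Msub n k l :=
    le_sup_left (a := NY' n k l ⊔ ⁅NY n k l, NY n k l⁆)
      (le_sup_right (a := NY' n k l) (Subgroup.commutator_mem_commutator (b⁻¹).2 (a⁻¹).2))
  simpa [commutatorElement_def, mul_assoc] using h

/-- The commutative group structure on `N_Y/M`. -/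
abbrev QNYcomm (n k l : ℕ) [hk : Fact (0 < k)] : CommGroup (QNY n k l) :=
  { (inferInstance : Group (QNY n k l)) with mul_comm := QNY_comm n k l }

/-- Elements of `F` centralizing `N_Y` modulo `M`. -/
def Cent (n k l : ℕ) [hk : Fact (0 < k)] : Subgroup (FG n k l) :=
  (Subgroup.centralizer {QuotientGroup.mk' (Msub n k l) (y0 n k l)}).comap
    (QuotientGroup.mk' (Msub n k l))

theorem mem_Cent (n k l : ℕ) [hk : Fact (0 < k)] (u : FG n k l)
    (h : ⁅y0 n k l, u⁆ ∈ Msub n k l) : u ∈ Cent n k l := by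
  rw [← QuotientGroup.eq_one_iff] at h
  change QuotientGroup.mk' (Msub n k l) _ = 1 at h
  rw [map_commutatorElement, commutatorElement_eq_one_iff_mul_comm] at h
  rw [Cent, Subgroup.mem_comap, Subgroup.mem_centralizer_iff]
  rintro _ rfl
  exact h

theorem ker_le_Cent (n k l : ℕ) [hk : Fact (0 < k)] : (prQ n k l).ker ≤ Cent n k l := by
  have h1 : NY n k l ≤ Cent n k l := fun u hu => mem_Cent n k l u
    (le_sup_left (a := NY' n k l ⊔ ⁅NY n k l, NY n k l⁆)
      (le_sup_right (a := NY' n k l)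
        (Subgroup.commutator_mem_commutator (y0_mem_NY n k l) hu)))
  have h2 : ⁅(⊤ : Subgroup (FG n k l)), ⊤⁆ ≤ Cent n k l := fun u hu => mem_Cent n k l u
    (le_sup_right (a := NY' n k l ⊔ ⁅NY n k l, NY n k l⁆)
      (Subgroup.commutator_mem_commutator (y0_mem_NY n k l) hu))
  intro u hu
  have hu' : Abelianization.of u ∈ VY n k l := (QuotientGroup.eq_one_iff _).1 hu
  have h3 : VY n k l ≤ (NY n k l).map Abelianization.of := by
    refine (Subgroup.closure_le _).2 ?_
    rintro _ ⟨j, rfl⟩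
    exact ⟨_, Subgroup.subset_normalClosure ⟨j, rfl⟩, rfl⟩
  obtain ⟨w, hw, hwu⟩ := h3 hu'
  have h4 : w⁻¹ * u ∈ commutator (FG n k l) := by
    rw [← Abelianization.ker_of, MonoidHom.mem_ker, map_mul, map_inv, hwu, inv_mul_cancel]
  have := (Cent n k l).mul_mem (h1 hw) (h2 h4)
  simpa using this

/-- The element `y^v` for `v ∈ F`. -/
def yv (n k l : ℕ) [hk : Fact (0 < k)] (v : FG n k l) : QNY n k l :=
  QuotientGroup.mk ⟨v * y0 n k l * v⁻¹, conj_y0_mem_NY n k l v⟩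

theorem yv_eq (n k l : ℕ) [hk : Fact (0 < k)] (v w : FG n k l)
    (h : prQ n k l v = prQ n k l w) : yv n k l v = yv n k l w := by
  have hu : v⁻¹ * w ∈ Cent n k l := by
    apply ker_le_Cent
    rw [MonoidHom.mem_ker, map_mul, map_inv, h, inv_mul_cancel]
  refine (QuotientGroup.eq (s := (Msub n k l).subgroupOf (NY n k l))).2 ?_
  rw [Subgroup.mem_subgroupOf, ← QuotientGroup.eq_one_iff]
  change QuotientGroup.mk' (Msub n k l) ((v * y0 n k l * v⁻¹)⁻¹ * (w * y0 n k l * w⁻¹)) = 1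
  rw [Cent, Subgroup.mem_comap, Subgroup.mem_centralizer_iff] at hu
  replace hu := hu _ rfl
  have hw : w = v * (v⁻¹ * w) := by group
  generalize v⁻¹ * w = u at hu hw
  subst hw
  simp only [map_mul, map_inv] at hu ⊢
  rw [inv_mul_eq_one]
  generalize (QuotientGroup.mk' (Msub n k l)) u = u at *
  rw [mul_assoc _ u, ← hu]
  group

theorem prQ_surj (n k l : ℕ) : Function.Surjective (prQ n k l) := by
  intro q
  obtain ⟨a, rfl⟩ := QuotientGroup.mk_surjective q
  obtain ⟨v, rfl⟩ := QuotientGroup.mk_surjective a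
  exact ⟨v, rfl⟩

/-- The inverse map. -/
theorem exists_inv (n k l : ℕ) [hk : Fact (0 < k)] :
    ∃ s : Multiplicative (QQ n k l →₀ ℤ) →* QNY n k l,
      ∀ v, s (Multiplicative.ofAdd (Finsupp.single (prQ n k l v) 1)) = yv n k l v := by
  let _ := QNYcomm n k l
  let f : (QQ n k l →₀ ℤ) →+ Additive (QNY n k l) :=
    Finsupp.liftAddHom fun q => (zmultiplesHom (Additive (QNY n k l)))
      (Additive.ofMul (yv n k l (Function.surjInv (prQ_surj n k l) q)))
  refine ⟨AddMonoidHom.toMultiplicativeLeft f, fun v => ?_⟩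
  change Additive.toMul (f (Finsupp.single (prQ n k l v) 1)) = _
  have : f (Finsupp.single (prQ n k l v) 1) =
      Additive.ofMul (yv n k l (Function.surjInv (prQ_surj n k l) (prQ n k l v))) := by
    simp [f]
  rw [this]
  exact yv_eq n k l _ _ (Function.surjInv_eq (prQ_surj n k l) _)

theorem eHom_yv (n k l : ℕ) [hk : Fact (0 < k)] (v : FG n k l) :
    eHom n k l (yv n k l v) = Multiplicative.ofAdd (Finsupp.single (prQ n k l v) 1) :=
  leftHom_conj n k l v

/-- `N_Y/M` is generated by the `y^v`. -/
theorem QNY_gen (n k l : ℕ) [hk : Fact (0 < k)] (f : QNY n k l →* QNY n k l)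
    (hf : ∀ v, f (yv n k l v) = yv n k l v) (a : QNY n k l) : f a = a := by
  obtain ⟨⟨a, ha⟩, rfl⟩ := QuotientGroup.mk_surjective a
  let π : NY n k l →* QNY n k l := QuotientGroup.mk' ((Msub n k l).subgroupOf (NY n k l))
  change f (π ⟨a, ha⟩) = π ⟨a, ha⟩
  have ha' := ha
  unfold NY Subgroup.normalClosure at ha'
  induction ha' using Subgroup.closure_induction with
  | mem x hx =>
    obtain ⟨_, ⟨j, rfl⟩, hc⟩ := Group.mem_conjugatesOfSet_iff.1 hx
    obtain ⟨c, rfl⟩ := isConj_iff.1 hc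
    by_cases hj : j = ⟨0, hk.out⟩
    · subst hj
      exact hf c
    · have : π ⟨_, ha⟩ = 1 := by
        refine (QuotientGroup.eq_one_iff _).2 ?_
        rw [Subgroup.mem_subgroupOf]
        refine le_sup_left (a := NY' n k l ⊔ ⁅NY n k l, NY n k l⁆)
          (le_sup_left (a := NY' n k l) ?_)
        exact (NY'_normal n k l).conj_mem _ (Subgroup.subset_normalClosure ⟨j, hj, rfl⟩) c
      rw [this, map_one]
  | one =>
    have : π ⟨1, ha⟩ = 1 := map_one π
    rw [this, map_one]
  | mul x y hx hy ihx ihy =>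
    have : π ⟨x * y, ha⟩ = π ⟨x, hx⟩ * π ⟨y, hy⟩ := map_mul π ⟨x, hx⟩ ⟨y, hy⟩
    rw [this, map_mul, ihx hx, ihy hy]
  | inv x hx ih =>
    have : π ⟨x⁻¹, ha⟩ = (π ⟨x, hx⟩)⁻¹ := map_inv π ⟨x, hx⟩
    rw [this, map_inv, ih hx]

end Helpers

/-- **Lemma (structure of `N_Y/M`).**  The group `N_Y/M` is abelian, and it is a free
`ℤ`-module with basis `{y^v : v ∈ V̄/V̄_Y}`, where `y^v` is the common image in `N_Y/M` of the
elements `ṽ y ṽ⁻¹` for `ṽ ∈ F` projecting to `v`.  Freeness is expressed by an isomorphism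
with the free abelian group `(V̄/V̄_Y) →₀ ℤ` carrying `y^v` to the basis element at `v`;
in particular `v ↦ y^v` is injective and its image is a `ℤ`-basis. -/
theorem NY_mod_M_free_abelian (n k l : ℕ) [Fact (0 < k)] :
    (∀ a b : QNY n k l, a * b = b * a) ∧
    ∃ e : QNY n k l ≃* Multiplicative ((Abelianization (FG n k l) ⧸ VY n k l) →₀ ℤ),
      ∀ v : FG n k l,
        e (QuotientGroup.mk ⟨v * y0 n k l * v⁻¹, conj_y0_mem_NY n k l v⟩) =
          Multiplicative.ofAdd
            (Finsupp.single (QuotientGroup.mk (Abelianization.of v)) 1) := by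
  refine ⟨QNY_comm n k l, ?_⟩
  obtain ⟨s, hs⟩ := exists_inv n k l
  refine ⟨MonoidHom.toMulEquiv (eHom n k l) s ?_ ?_, fun v => eHom_yv n k l v⟩
  · ext a
    refine QNY_gen n k l (s.comp (eHom n k l)) (fun v => ?_) a
    rw [MonoidHom.comp_apply, eHom_yv, hs]
  · have : MonoidHom.toAdditiveRight ((eHom n k l).comp s) =
        MonoidHom.toAdditiveRight (MonoidHom.id _) := by
      refine Finsupp.addHom_ext' fun q => AddMonoidHom.ext_int ?_
      obtain ⟨v, rfl⟩ := prQ_surj n k l q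
      change eHom n k l (s (Multiplicative.ofAdd (Finsupp.single (prQ n k l v) 1))) =
        Multiplicative.ofAdd (Finsupp.single (prQ n k l v) 1)
      rw [hs, eHom_yv]
    exact MonoidHom.toAdditiveRight.injective this

end Birman
end
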